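/- (Proposition 3.3(i)) For every p ∈ M̃⁴, the three vectors X1(p), X2(p), X3(p) ∈ ℝ⁶ are linearly independent. -/

import Mathlib

noncomputable section

/-- `ℝ⁶` with its Euclidean inner product; coordinates `p 0, p 1, p 2` are `x₁, x₂, x₃`
and `p 3, p 4, p 5` are `y₁, y₂, y₃`. -/
abbrev E6 := EuclideanSpace ℝ (Fin 6)

/-- The point of `ℝ⁶` with the given six coordinates. -/
noncomputable def mk6 (a b c d e f : ℝ) : E6 :=
  (EuclideanSpace.equiv (Fin 6) ℝ).symm ![a, b, c, d, e, f]

/-- The polynomial `F` of Proposition 3.2. -/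
noncomputable def Fq (p : E6) : ℝ :=
  9 * (p 0) ^ 2 * (p 2) ^ 8 * ((p 1) ^ 2 + (p 2) ^ 2) * (p 3) ^ 2
    + 9 * (p 0) ^ 8 * (p 1) ^ 2 * ((p 0) ^ 2 - (p 2) ^ 2) * (p 4) ^ 2
    - 9 * (p 1) ^ 8 * (p 2) ^ 2 * ((p 0) ^ 2 + (p 1) ^ 2) * (p 5) ^ 2
    - (p 0) ^ 2 * (p 1) ^ 2 * (p 2) ^ 2 *
      (2 * (p 0) ^ 2 * (p 1) ^ 4 - 2 * (p 0) ^ 2 * (p 2) ^ 4 - 2 * (p 1) ^ 2 * (p 2) ^ 4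
        - (p 0) ^ 2 * (p 1) ^ 2 * (p 2) ^ 2)

/-- The polynomial `G` of Proposition 3.2. -/
noncomputable def Gq (p : E6) : ℝ := (p 1) ^ 2 - (p 0) ^ 2 - (p 2) ^ 2

/-- The algebraic variety `M⁴`. -/
def M4 : Set E6 :=
  {p | Fq p = 0 ∧ Gq p = 0 ∧ 0 < p 0 ∧ 0 < p 1 ∧ 0 < p 2 ∧ ¬(p 3 = 0 ∧ p 4 = 0 ∧ p 5 = 0)}

/-- The half line `ℓ₊`: points of `M⁴` with `x = s(1, √2, 1)`, `s > 0`, `y = (0, 1, 0)`. -/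
def ellP : Set E6 :=
  {p ∈ M4 | ∃ s : ℝ, 0 < s ∧ p 0 = s ∧ p 1 = s * Real.sqrt 2 ∧ p 2 = s ∧
    p 3 = 0 ∧ p 4 = 1 ∧ p 5 = 0}

/-- The half line `ℓ₋`: points of `M⁴` with `x = s(1, √2, 1)`, `s > 0`, `y = (0, -1, 0)`. -/
def ellM : Set E6 :=
  {p ∈ M4 | ∃ s : ℝ, 0 < s ∧ p 0 = s ∧ p 1 = s * Real.sqrt 2 ∧ p 2 = s ∧
    p 3 = 0 ∧ p 4 = -1 ∧ p 5 = 0}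

/-- The regular part `M̃⁴ = M⁴ \ (ℓ₋ ∪ ℓ₊)`. -/
def Mt4 : Set E6 := M4 \ (ellM ∪ ellP)

/-- `A₁` of Proposition 3.3. -/
noncomputable def A1 (p : E6) : ℝ :=
  (1 / (p 1) ^ 4) * (3 * (p 1) ^ 4 - (p 2) ^ 4) * (p 3) ^ 2
    - ((p 0) ^ 6 / (p 2) ^ 8) * (3 * (p 0) ^ 2 - 2 * (p 2) ^ 2) * (p 4) ^ 2
    + ((p 1) ^ 4 / ((p 0) ^ 2 * (p 2) ^ 4)) * (3 * (p 0) ^ 2 + 2 * (p 1) ^ 2) * (p 5) ^ 2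
    + (1 / (9 * (p 2) ^ 4)) * (5 * (p 0) ^ 4 + 2 * (p 1) ^ 2 * (p 2) ^ 2)

/-- `A₂` of Proposition 3.3. -/
noncomputable def A2 (p : E6) : ℝ :=
  -((p 2) ^ 4 / ((p 0) ^ 4 * (p 1) ^ 2)) * (3 * (p 1) ^ 2 + 2 * (p 2) ^ 2) * (p 3) ^ 2
    - (1 / (p 2) ^ 4) * ((p 0) ^ 4 - 3 * (p 2) ^ 4) * (p 4) ^ 2
    - ((p 1) ^ 6 / (p 0) ^ 8) * (2 * (p 0) ^ 2 + 3 * (p 1) ^ 2) * (p 5) ^ 2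
    - (1 / (9 * (p 0) ^ 4)) * (5 * (p 1) ^ 4 - 2 * (p 0) ^ 2 * (p 2) ^ 2)

/-- `A₃` of Proposition 3.3. -/
noncomputable def A3 (p : E6) : ℝ :=
  ((p 2) ^ 6 / (p 1) ^ 8) * (2 * (p 1) ^ 2 + 3 * (p 2) ^ 2) * (p 3) ^ 2
    + ((p 0) ^ 4 / ((p 1) ^ 4 * (p 2) ^ 2)) * (2 * (p 0) ^ 2 - 3 * (p 2) ^ 2) * (p 4) ^ 2
    + (1 / (p 0) ^ 4) * (3 * (p 0) ^ 4 - (p 1) ^ 4) * (p 5) ^ 2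
    + (1 / (9 * (p 1) ^ 4)) * (5 * (p 2) ^ 4 + 2 * (p 0) ^ 2 * (p 1) ^ 2)

/-- The vector field `X₁` of Proposition 3.3. -/
noncomputable def X1 (p : E6) : E6 :=
  mk6 ((1 / (p 1) ^ 4) * (((p 1) ^ 4 + (p 1) ^ 2 * (p 2) ^ 2 + (p 2) ^ 4) * p 0 * p 3))
      ((1 / (p 1) ^ 4) * ((p 1) ^ 5 * p 3))
      ((1 / (p 1) ^ 4) * ((p 2) ^ 5 * p 3))
      ((1 / (p 1) ^ 4) * ((p 1) ^ 4 * A1 p))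
      ((1 / (p 1) ^ 4) * (2 * (p 0) ^ 2 * (p 1) ^ 2 * p 3 * p 4))
      ((1 / (p 1) ^ 4) * ((8 * (p 2) ^ 2 + 2 * (p 0) ^ 2) * (p 2) ^ 2 * p 3 * p 5))

/-- The vector field `X₂` of Proposition 3.3. -/
noncomputable def X2 (p : E6) : E6 :=
  mk6 ((1 / (p 2) ^ 4) * ((p 0) ^ 5 * p 4))
      ((1 / (p 2) ^ 4) * (((p 0) ^ 4 - (p 0) ^ 2 * (p 2) ^ 2 + (p 2) ^ 4) * p 1 * p 4))
      ((1 / (p 2) ^ 4) * ((p 2) ^ 5 * p 4))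
      ((1 / (p 2) ^ 4) * ((8 * (p 0) ^ 2 - 2 * (p 1) ^ 2) * (p 0) ^ 2 * p 3 * p 4))
      ((1 / (p 2) ^ 4) * ((p 2) ^ 4 * A2 p))
      ((1 / (p 2) ^ 4) * (2 * (p 1) ^ 2 * (p 2) ^ 2 * p 4 * p 5))

/-- The vector field `X₃` of Proposition 3.3. -/
noncomputable def X3 (p : E6) : E6 :=
  mk6 ((1 / (p 0) ^ 4) * ((p 0) ^ 5 * p 5))
      ((1 / (p 0) ^ 4) * ((p 1) ^ 5 * p 5))
      ((1 / (p 0) ^ 4) * (((p 0) ^ 4 + (p 0) ^ 2 * (p 1) ^ 2 + (p 1) ^ 4) * p 2 * p 5))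
      ((1 / (p 0) ^ 4) * (-2 * (p 0) ^ 2 * (p 2) ^ 2 * p 3 * p 5))
      ((1 / (p 0) ^ 4) * ((8 * (p 1) ^ 2 - 2 * (p 2) ^ 2) * (p 1) ^ 2 * p 4 * p 5))
      ((1 / (p 0) ^ 4) * ((p 0) ^ 4 * A3 p))

/-- The indexed family `X₁, X₂, X₃`. -/
noncomputable def Xv : Fin 3 → E6 → E6 := ![X1, X2, X3]

/-- `F` in terms of the squares `a = x₁²`, `b = x₂²`, `c = x₃²` and `Yᵢ = yᵢ²`. -/
def polyF (a b c Y₁ Y₂ Y₃ : ℝ) : ℝ :=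
  9 * a * c ^ 4 * (b + c) * Y₁ + 9 * a ^ 4 * b * (a - c) * Y₂ - 9 * b ^ 4 * c * (a + b) * Y₃
    - a * b * c * (2 * a * b ^ 2 - 2 * a * c ^ 2 - 2 * b * c ^ 2 - a * b * c)

/-- `9 a b² c⁴ A₁` in terms of the squares. -/
def polyA1 (a b c Y₁ Y₂ Y₃ : ℝ) : ℝ :=
  9 * a * c ^ 4 * (3 * b ^ 2 - c ^ 2) * Y₁ - 9 * a ^ 4 * b ^ 2 * (3 * a - 2 * c) * Y₂
    + 9 * b ^ 4 * c ^ 2 * (3 * a + 2 * b) * Y₃ + a * b ^ 2 * c ^ 2 * (5 * a ^ 2 + 2 * b * c)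

/-- `9 a⁴ b c² A₂` in terms of the squares. -/
def polyA2 (a b c Y₁ Y₂ Y₃ : ℝ) : ℝ :=
  -9 * a ^ 2 * c ^ 4 * (3 * b + 2 * c) * Y₁ - 9 * a ^ 4 * b * (a ^ 2 - 3 * c ^ 2) * Y₂
    - 9 * b ^ 4 * c ^ 2 * (2 * a + 3 * b) * Y₃ - a ^ 2 * b * c ^ 2 * (5 * b ^ 2 - 2 * a * c)

/-- `9 a² b⁴ c A₃` in terms of the squares. -/
def polyA3 (a b c Y₁ Y₂ Y₃ : ℝ) : ℝ :=
  9 * a ^ 2 * c ^ 4 * (2 * b + 3 * c) * Y₁ + 9 * a ^ 4 * b ^ 2 * (2 * a - 3 * c) * Y₂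
    + 9 * b ^ 4 * c * (3 * a ^ 2 - b ^ 2) * Y₃ + a ^ 2 * b ^ 2 * c * (5 * c ^ 2 + 2 * a * b)

theorem Fq_eq_polyF (p : E6) :
    Fq p = polyF (p 0 ^ 2) (p 1 ^ 2) (p 2 ^ 2) (p 3 ^ 2) (p 4 ^ 2) (p 5 ^ 2) := by
  unfold Fq polyF; ring

theorem polyA1_eq {p : E6} (h0 : p 0 ≠ 0) (h1 : p 1 ≠ 0) (h2 : p 2 ≠ 0) :
    polyA1 (p 0 ^ 2) (p 1 ^ 2) (p 2 ^ 2) (p 3 ^ 2) (p 4 ^ 2) (p 5 ^ 2) =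
      9 * p 0 ^ 2 * p 1 ^ 4 * p 2 ^ 8 * A1 p := by
  unfold A1 polyA1; field_simp

theorem polyA2_eq {p : E6} (h0 : p 0 ≠ 0) (h1 : p 1 ≠ 0) (h2 : p 2 ≠ 0) :
    polyA2 (p 0 ^ 2) (p 1 ^ 2) (p 2 ^ 2) (p 3 ^ 2) (p 4 ^ 2) (p 5 ^ 2) =
      9 * p 0 ^ 8 * p 1 ^ 2 * p 2 ^ 4 * A2 p := by
  unfold A2 polyA2; field_simp

theorem polyA3_eq {p : E6} (h0 : p 0 ≠ 0) (h1 : p 1 ≠ 0) (h2 : p 2 ≠ 0) :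
    polyA3 (p 0 ^ 2) (p 1 ^ 2) (p 2 ^ 2) (p 3 ^ 2) (p 4 ^ 2) (p 5 ^ 2) =
      9 * p 0 ^ 4 * p 1 ^ 8 * p 2 ^ 2 * A3 p := by
  unfold A3 polyA3; field_simp

section Squares

variable {a b c Y₁ Y₂ Y₃ : ℝ}

/-- `F`, `A₁` and the square `Y₁` vanish together only where `x₁ = x₃`, `y = (0, ±1, 0)`. -/
theorem eq_of_polyA1_eq_zero (ha : 0 < a) (hc : 0 < c) (hb : b = a + c) (h₃ : 0 ≤ Y₃)
    (hF : polyF a b c 0 Y₂ Y₃ = 0) (hA : polyA1 a b c 0 Y₂ Y₃ = 0) :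
    a = c ∧ Y₂ = 1 ∧ Y₃ = 0 := by
  have hb0 : 0 < b := by linarith
  have key₃ : 54 * a ^ 5 * b ^ 5 * c * (9 * a ^ 2 * Y₃ + (a - c) ^ 2) = 0 := by
    unfold polyF at hF; unfold polyA1 at hA; subst hb
    linear_combination -9 * a ^ 4 * (a + c) * (a - c) * hA
      - 9 * a ^ 4 * (a + c) ^ 2 * (3 * a - 2 * c) * hF
  have h : 9 * a ^ 2 * Y₃ + (a - c) ^ 2 = 0 := by
    simpa [ha.ne', hb0.ne', hc.ne'] using key₃
  have hac : a = c := by nlinarith [mul_nonneg (sq_nonneg a) h₃, sq_nonneg (a - c)]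
  have hY : Y₃ = 0 := by simpa [hac, hc.ne'] using h
  refine ⟨hac, ?_, hY⟩
  unfold polyA1 at hA; subst hY hb hac
  have : 36 * a ^ 7 * (Y₂ - 1) = 0 := by linear_combination -hA
  simpa [ha.ne', sub_eq_zero] using this

/-- `F`, `A₂` and the square `Y₂` have no common zero. -/
theorem polyA2_ne_zero (ha : 0 < a) (hc : 0 < c) (hb : b = a + c) (h₁ : 0 ≤ Y₁)
    (hF : polyF a b c Y₁ 0 Y₃ = 0) : polyA2 a b c Y₁ 0 Y₃ ≠ 0 := by
  intro hA
  have hb0 : 0 < b := by linarith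
  have key : 54 * a * b ^ 5 * c ^ 5 * (9 * b ^ 2 * Y₁ + (2 * a + c) ^ 2) = 0 := by
    unfold polyF at hF; unfold polyA2 at hA; subst hb
    linear_combination -9 * (a + c) ^ 4 * c * (2 * a + c) * hA
      + 9 * (a + c) ^ 4 * c ^ 2 * (5 * a + 3 * c) * hF
  have : 0 < 54 * a * b ^ 5 * c ^ 5 * (9 * b ^ 2 * Y₁ + (2 * a + c) ^ 2) := by positivity
  exact this.ne' key

/-- `F`, `A₃` and the square `Y₃` vanish together only where `x₁ = x₃`, `y = (0, ±1, 0)`. -/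
theorem eq_of_polyA3_eq_zero (ha : 0 < a) (hc : 0 < c) (hb : b = a + c) (h₁ : 0 ≤ Y₁)
    (hF : polyF a b c Y₁ Y₂ 0 = 0) (hA : polyA3 a b c Y₁ Y₂ 0 = 0) :
    a = c ∧ Y₂ = 1 ∧ Y₁ = 0 := by
  have hb0 : 0 < b := by linarith
  have key₁ : 54 * a ^ 5 * b * c * (9 * c ^ 6 * Y₁ + b ^ 4 * (a - c) ^ 2) = 0 := by
    unfold polyF at hF; unfold polyA3 at hA; subst hb
    linear_combination 9 * a ^ 4 * (a + c) * (a - c) * hA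
      - 9 * a ^ 4 * (a + c) ^ 2 * (2 * a - 3 * c) * hF
  have h : 9 * c ^ 6 * Y₁ + b ^ 4 * (a - c) ^ 2 = 0 := by
    simpa [ha.ne', hb0.ne', hc.ne'] using key₁
  have hY : Y₁ = 0 := by
    have h6 : 0 < 9 * c ^ 6 := by positivity
    have h4 : 0 ≤ b ^ 4 * (a - c) ^ 2 := by positivity
    nlinarith [mul_nonneg h6.le h₁]
  have hac : a = c := by simpa [hY, hb0.ne', sub_eq_zero] using h
  refine ⟨hac, ?_, hY⟩
  unfold polyA3 at hA; subst hY hb hac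
  have : 36 * a ^ 7 * (Y₂ - 1) = 0 := by linear_combination -hA
  simpa [ha.ne', sub_eq_zero] using this

/-- The conditions that the `y₁`- and `y₂`-components impose on a dependency `∑ λᵢ Xᵢ = 0` with
some `λᵢ yᵢ ≠ 0` are incompatible with `F = 0`. -/
theorem false_of_polyF_of_weighted (ha : 0 < a) (hc : 0 < c) (hb : b = a + c)
    (hF : polyF a b c Y₁ Y₂ Y₃ = 0)
    (h₁ : a ^ 2 * b ^ 2 * polyA1 a b c Y₁ Y₂ Y₃ =
      9 * a * b ^ 2 * c ^ 4 * (b ^ 3 * (8 * a - 2 * b) + 2 * c ^ 4) * Y₁)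
    (h₂ : b ^ 3 * c ^ 2 * polyA2 a b c Y₁ Y₂ Y₃ =
      9 * a ^ 4 * b * c ^ 2 * (2 * a ^ 4 * b + b * c ^ 3 * (8 * b - 2 * c)) * Y₂) : False := by
  have hb0 : 0 < b := by linarith
  have h : 0 < 5832 * a ^ 8 * b ^ 7 * (2 * a + c) * c ^ 13 := by positivity
  refine h.ne' ?_
  unfold polyF at hF; unfold polyA1 at h₁; unfold polyA2 at h₂; subst hb
  -- The weights are the `2 × 2` minors of the coefficients of `Y₁` and `Y₂`.
  linear_combination
    ((-9 * a ^ 3 * (a + c) ^ 2 * c ^ 4 * (10 * c ^ 2 + 10 * a * c + 3 * a ^ 2)) *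
          (-9 * a ^ 4 * (a + c) ^ 4 * c ^ 2 * (3 * c ^ 2 - 4 * a * c + 3 * a ^ 2))
      - (9 * a ^ 6 * (a + c) ^ 4 * (2 * c - 3 * a)) *
          (-9 * a ^ 2 * (a + c) ^ 3 * c ^ 6 * (5 * c + 3 * a))) * hF
    - ((9 * a * c ^ 4 * (a + 2 * c)) *
          (-9 * a ^ 4 * (a + c) ^ 4 * c ^ 2 * (3 * c ^ 2 - 4 * a * c + 3 * a ^ 2))
      - (9 * a ^ 4 * (a + c) * (a - c)) * (-9 * a ^ 2 * (a + c) ^ 3 * c ^ 6 * (5 * c + 3 * a))) * h₁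
    + ((9 * a * c ^ 4 * (a + 2 * c)) * (9 * a ^ 6 * (a + c) ^ 4 * (2 * c - 3 * a))
      - (9 * a ^ 4 * (a + c) * (a - c)) *
          (-9 * a ^ 3 * (a + c) ^ 2 * c ^ 4 * (10 * c ^ 2 + 10 * a * c + 3 * a ^ 2))) * h₂

end Squares

/-- The relations forced on a dependency by the `x`-components of the vector fields. -/
theorem exists_weight {a b c m₁ m₂ m₃ : ℝ} (ha : 0 < a) (hc : 0 < c) (hb : b = a + c)
    (e₁ : m₁ * (b ^ 2 + b * c + c ^ 2) + m₂ * a ^ 2 + m₃ * a ^ 2 = 0)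
    (e₃ : m₁ * c ^ 2 + m₂ * c ^ 2 + m₃ * (a ^ 2 + a * b + b ^ 2) = 0) :
    ∃ k, m₁ = -k * a ^ 3 ∧ m₂ = k * b ^ 3 ∧ m₃ = -k * c ^ 3 := by
  subst hb
  have h₁ : c ^ 3 * m₁ = a ^ 3 * m₃ := by
    have : 3 * (a + c) * (c ^ 3 * m₁ - a ^ 3 * m₃) = 0 := by
      linear_combination c ^ 2 * e₁ - a ^ 2 * e₃
    have h : 3 * (a + c) ≠ 0 := by positivity
    simpa [sub_eq_zero] using (mul_eq_zero.mp this).resolve_left h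
  have h₂ : c ^ 3 * m₂ = -(a + c) ^ 3 * m₃ := by
    linear_combination c * e₃ - h₁
  refine ⟨-m₃ / c ^ 3, ?_, ?_, ?_⟩ <;> field_simp <;> linarith

/-- A point whose squared coordinates are those of the exceptional half lines is not in `M̃⁴`. -/
theorem notMem_Mt4_of_sq {p : E6} (h : p 0 ^ 2 = p 2 ^ 2) (h3 : p 3 ^ 2 = 0) (h4 : p 4 ^ 2 = 1)
    (h5 : p 5 ^ 2 = 0) : p ∉ Mt4 := by
  rintro ⟨hM, hl⟩
  obtain ⟨-, hG, h0, h1, h2, -⟩ := id hM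
  have h02 : p 2 = p 0 := by
    rw [sq_eq_sq₀ h0.le h2.le] at h; exact h.symm
  have h1' : p 1 = p 0 * √2 := by
    rw [← sq_eq_sq₀ h1.le (by positivity), mul_pow, Real.sq_sqrt zero_le_two]
    unfold Gq at hG; linarith
  rw [sq_eq_zero_iff] at h3 h5
  refine hl ?_
  rw [sq, mul_self_eq_one_iff] at h4
  rcases h4 with h | h
  · exact Or.inr ⟨hM, p 0, h0, rfl, h1', h02, h3, h, h5⟩
  · exact Or.inl ⟨hM, p 0, h0, rfl, h1', h02, h3, h, h5⟩

/-- Proposition 3.3(i): `X₁(p), X₂(p), X₃(p)` are linearly independent at every point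
of `M̃⁴`. -/
theorem statement_14 (p : E6) (hp : p ∈ Mt4) :
    LinearIndependent ℝ ![X1 p, X2 p, X3 p] := by
  obtain ⟨hF, hG, h0, h1, h2, -⟩ := hp.1
  rw [Fq_eq_polyF] at hF
  have hb : p 1 ^ 2 = p 0 ^ 2 + p 2 ^ 2 := by unfold Gq at hG; linarith
  have ha : 0 < p 0 ^ 2 := by positivity
  have hc : 0 < p 2 ^ 2 := by positivity
  have q1 := polyA1_eq h0.ne' h1.ne' h2.ne'
  have q2 := polyA2_eq h0.ne' h1.ne' h2.ne'
  have q3 := polyA3_eq h0.ne' h1.ne' h2.ne'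
  rw [Fintype.linearIndependent_iff]
  intro g hg
  rw [Fin.sum_univ_three] at hg
  have comp (i : Fin 6) : g 0 * X1 p i + g 1 * X2 p i + g 2 * X3 p i = 0 := by
    simpa using congrArg (fun v : E6 => v i) hg
  have c0 := comp 0
  have c2 := comp 2
  have c3 := comp 3
  have c4 := comp 4
  have c5 := comp 5
  simp only [X1, X2, X3, mk6, EuclideanSpace.equiv, PiLp.continuousLinearEquiv_symm_apply,
    Matrix.cons_val] at c0 c2 c3 c4 c5
  obtain ⟨k, k1, k2, k3⟩ := exists_weight (m₁ := g 0 * p 3 / p 1 ^ 4) (m₂ := g 1 * p 4 / p 2 ^ 4)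
    (m₃ := g 2 * p 5 / p 0 ^ 4) ha hc hb
    (by
      refine mul_left_cancel₀ h0.ne' ?_
      rw [mul_zero, ← c0]; field_simp)
    (by
      refine mul_left_cancel₀ h2.ne' ?_
      rw [mul_zero, ← c2]; field_simp)
  rw [div_eq_iff (by positivity)] at k1 k2 k3
  field_simp at c3 c4 c5
  have hk : k = 0 := by
    by_contra hk
    refine false_of_polyF_of_weighted ha hc hb hF ?_ ?_
    · refine mul_left_cancel₀ (mul_ne_zero hk ha.ne') ?_
      rw [q1]
      linear_combination -9 * p 1 ^ 4 * p 2 ^ 4 * (p 3 * c3 - A1 p * p 0 ^ 2 * p 2 ^ 4 * k1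
        - (8 * p 0 ^ 2 - 2 * p 1 ^ 2) * p 0 ^ 4 * p 3 ^ 2 * k2 + 2 * p 2 ^ 6 * p 3 ^ 2 * k3)
    · refine mul_left_cancel₀ hk ?_
      rw [q2]
      linear_combination 9 * p 0 ^ 4 * p 2 ^ 4 * (p 4 * c4 - 2 * p 0 ^ 6 * p 4 ^ 2 * k1
        - p 0 ^ 4 * p 1 ^ 2 * A2 p * k2
        - (8 * p 1 ^ 2 - 2 * p 2 ^ 2) * p 1 ^ 4 * p 4 ^ 2 * k3)
  simp only [hk, neg_zero, zero_mul, mul_eq_zero] at k1 k2 k3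
  have g0 : g 0 = 0 := by
    by_contra hg0
    have hy := k1.resolve_left hg0
    have hA : A1 p = 0 := by simpa [hy, hg0, h0.ne', h2.ne'] using c3
    rw [hA, mul_zero] at q1
    simp only [hy, ne_eq, OfNat.ofNat_ne_zero, not_false_eq_true, zero_pow] at q1 hF
    obtain ⟨h, h4, h5⟩ := eq_of_polyA1_eq_zero ha hc hb (sq_nonneg _) hF q1
    exact notMem_Mt4_of_sq h (by simp [hy]) h4 h5 hp
  have g1 : g 1 = 0 := by
    by_contra hg1
    have hy := k2.resolve_left hg1
    have hA : A2 p = 0 := by simpa [hy, hg1, h0.ne', h1.ne'] using c4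
    rw [hA, mul_zero] at q2
    simp only [hy, ne_eq, OfNat.ofNat_ne_zero, not_false_eq_true, zero_pow] at q2 hF
    exact polyA2_ne_zero ha hc hb (sq_nonneg _) hF q2
  have g2 : g 2 = 0 := by
    by_contra hg2
    have hy := k3.resolve_left hg2
    have hA : A3 p = 0 := by simpa [hy, hg2, h1.ne', h2.ne'] using c5
    rw [hA, mul_zero] at q3
    simp only [hy, ne_eq, OfNat.ofNat_ne_zero, not_false_eq_true, zero_pow] at q3 hF
    obtain ⟨h, h4, h3⟩ := eq_of_polyA3_eq_zero ha hc hb (sq_nonneg _) hF q3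
    exact notMem_Mt4_of_sq h h3 h4 (by simp [hy]) hp
  intro i
  fin_cases i
  exacts [g0, g1, g2]
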